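/- arXiv:2403.06948 — 3 statements merged into one kernel-verified Lean document; each statement's English description precedes it below -/
import Mathlib

section
/- Let n ≥ 1, a ∈ Fin n, and let I, J be k-element subsets of Fin n with I ≤_a J in the Gale order. Then the complements satisfy (Fin n) \ J ≤_a (Fin n) \ I in the Gale order on (n−k)-element subsets. -/
/-- The position of `i` in the cyclic rotation of the natural order on `Fin n`
that has minimum `a`; i.e. the value `(i - a) mod n`. -/
def cycVal {n : ℕ} (a i : Fin n) : ℕ := (i.val + n - a.val) % n

/-- The linear order `≤_a` on `Fin n`: `i ≤_a j` iff `(i - a) mod n ≤ (j - a) mod n`. -/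
def cycLE {n : ℕ} (a i j : Fin n) : Prop := cycVal a i ≤ cycVal a j

instance {n : ℕ} (a : Fin n) : DecidableRel (cycLE a) := fun i j =>
  inferInstanceAs (Decidable (cycVal a i ≤ cycVal a j))

/-- The elements of the finite set `I` listed in increasing order with respect to `≤_a`. -/
noncomputable def cycSort {n : ℕ} (a : Fin n) (I : Finset (Fin n)) : List (Fin n) :=
  I.toList.insertionSort (cycLE a)

/-- The Gale order `≤_a` on finite subsets of `Fin n`:
`I ≤_a J` iff (the sets have the same size and) the `s`-th smallest element of `I`
with respect to `≤_a` is `≤_a` the `s`-th smallest element of `J`, for every `s`. -/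
def galeLE {n : ℕ} (a : Fin n) (I J : Finset (Fin n)) : Prop :=
  List.Forall₂ (cycLE a) (cycSort a I) (cycSort a J)

theorem List.Forall₂.countP_le_of_le {α β : Type*} [LinearOrder β] {f : α → β} {L M : List α}
    (h : List.Forall₂ (fun x y => f x ≤ f y) L M) (t : β) :
    M.countP (fun x => f x ≤ t) ≤ L.countP (fun x => f x ≤ t) := by
  induction h with
  | nil => simp
  | @cons x y L M hxy _ ih =>
    simp only [List.countP_cons, decide_eq_true_eq]
    by_cases hy : f y ≤ t
    · simpa [hy, hxy.trans hy] using ih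
    · rw [if_neg hy]
      omega

theorem List.forall₂_le_of_countP_le {α β : Type*} [LinearOrder β] {f : α → β} {L M : List α}
    (hL : L.Pairwise (fun x y => f x ≤ f y)) (hM : M.Pairwise (fun x y => f x ≤ f y))
    (hlen : L.length = M.length)
    (h : ∀ t, M.countP (fun x => f x ≤ t) ≤ L.countP (fun x => f x ≤ t)) :
    List.Forall₂ (fun x y => f x ≤ f y) L M := by
  induction L generalizing M with
  | nil => cases M <;> simp_all
  | cons x L ih =>
    cases M with
    | nil => simp at hlen
    | cons y M =>
      rw [List.pairwise_cons] at hL hM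
      simp only [List.countP_cons, decide_eq_true_eq] at h
      have hxy : f x ≤ f y := by
        by_contra! hlt
        have hzero : L.countP (fun x => f x ≤ f y) = 0 := by
          rw [List.countP_eq_zero]
          intro z hz
          simpa using hlt.trans_le (hL.1 z hz)
        have := h (f y)
        simp [hzero, hlt.not_ge] at this
      refine .cons hxy (ih hL.2 hM.2 (by simpa using hlen) fun t => ?_)
      by_cases hy : f y ≤ t
      · simpa [hy, hxy.trans hy] using h t
      · have hzero : M.countP (fun x => f x ≤ t) = 0 := by
          rw [List.countP_eq_zero]
          intro z hz
          simpa using (not_le.mp hy).trans_le (hM.1 z hz)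
        omega

theorem cycSort_perm {n : ℕ} (a : Fin n) (I : Finset (Fin n)) :
    (cycSort a I).Perm I.toList :=
  List.perm_insertionSort _ _

theorem length_cycSort {n : ℕ} (a : Fin n) (I : Finset (Fin n)) :
    (cycSort a I).length = I.card := by
  rw [(cycSort_perm a I).length_eq, Finset.length_toList]

theorem pairwise_cycSort {n : ℕ} (a : Fin n) (I : Finset (Fin n)) :
    (cycSort a I).Pairwise (cycLE a) :=
  haveI : Std.Total (cycLE a) := ⟨fun i j => le_total (cycVal a i) (cycVal a j)⟩
  haveI : IsTrans (Fin n) (cycLE a) := ⟨fun _ _ _ => le_trans (α := ℕ)⟩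
  List.pairwise_insertionSort _ _

theorem countP_cycSort {n : ℕ} (a : Fin n) (I : Finset (Fin n)) (p : Fin n → Prop)
    [DecidablePred p] : (cycSort a I).countP (fun i => p i) = (I.filter p).card := by
  rw [(cycSort_perm a I).countP_eq, Finset.card_def, Finset.filter_val,
    ← Multiset.countP_eq_card_filter, ← Finset.coe_toList I, Multiset.coe_countP]

/-- The Gale order compares the sizes of the intersections with initial segments of `≤_a`. -/
theorem galeLE_iff_card_filter_le {n : ℕ} (a : Fin n) (I J : Finset (Fin n)) :
    galeLE a I J ↔ I.card = J.card ∧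
      ∀ t, (J.filter (fun i => cycVal a i ≤ t)).card ≤ (I.filter (fun i => cycVal a i ≤ t)).card := by
  simp only [← countP_cycSort a, ← length_cycSort a]
  exact ⟨fun h => ⟨h.length_eq, List.Forall₂.countP_le_of_le h⟩,
    fun h => List.forall₂_le_of_countP_le (pairwise_cycSort a I) (pairwise_cycSort a J) h.1 h.2⟩

theorem Finset.card_filter_add_card_filter_compl {α : Type*} [Fintype α] [DecidableEq α]
    (s : Finset α) (p : α → Prop) [DecidablePred p] :
    (s.filter p).card + (sᶜ.filter p).card = (Finset.univ.filter p).card := by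
  rw [← Finset.card_union_of_disjoint (Finset.disjoint_filter_filter disjoint_compl_right),
    ← Finset.filter_union, Finset.union_compl]

/-- Taking complements reverses the Gale order: if `I ≤_a J` for `k`-element subsets
`I, J` of `Fin n`, then `(Fin n) \ J ≤_a (Fin n) \ I`. -/
theorem galeLE_compl_antitone {n k : ℕ} (hn : 1 ≤ n) (a : Fin n)
    (I J : Finset (Fin n)) (hI : I.card = k) (hJ : J.card = k)
    (h : galeLE a I J) : galeLE a Jᶜ Iᶜ := by
  rw [galeLE_iff_card_filter_le] at h ⊢
  refine ⟨by rw [Finset.card_compl, Finset.card_compl, h.1], fun t => ?_⟩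
  have hIt := I.card_filter_add_card_filter_compl (fun i => cycVal a i ≤ t)
  have hJt := J.card_filter_add_card_filter_compl (fun i => cycVal a i ≤ t)
  have := h.2 t
  omega
end

section
/- Let n, k, r be natural numbers with 1 ≤ n − k, let L ⊆ Fin n, and let S_1, …, S_r be pairwise disjoint subsets of Fin n with S_i \ L nonempty for every i. Then there exists a matroid M on the full ground set Fin n such that rank(M) = n − k, the set of loops of M is exactly L, and rank_M(S_i) = 1 for every i, if and only if k + r ≥ |S_1 ∪ ⋯ ∪ S_r ∪ L|. -/
/-- The rank of a subset `S` in a matroid `M`: the maximum cardinality of an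
independent subset of `S`. -/
noncomputable def setRank {α : Type*} (M : Matroid α) (S : Set α) : ℕ :=
  sSup {c : ℕ | ∃ I, M.Indep I ∧ I ⊆ S ∧ I.ncard = c}

theorem le_setRank {α : Type*} [Finite α] {M : Matroid α} {I S : Set α}
    (hI : M.Indep I) (hIS : I ⊆ S) : I.ncard ≤ setRank M S := by
  refine le_csSup ⟨Nat.card α, ?_⟩ ⟨I, hI, hIS, rfl⟩
  rintro _ ⟨J, -, -, rfl⟩
  exact Set.ncard_le_card J

theorem setRank_le {α : Type*} {M : Matroid α} {S : Set α} {m : ℕ}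
    (h : ∀ I, M.Indep I → I ⊆ S → I.ncard ≤ m) : setRank M S ≤ m := by
  refine csSup_le ⟨0, ∅, M.empty_indep, Set.empty_subset S, Set.ncard_empty α⟩ ?_
  rintro _ ⟨I, hI, hIS, rfl⟩
  exact h I hI hIS

theorem exists_indep_ncard_eq_setRank {α : Type*} [Finite α] (M : Matroid α) (S : Set α) :
    ∃ I, M.Indep I ∧ I ⊆ S ∧ I.ncard = setRank M S := by
  refine Nat.sSup_mem (s := {c : ℕ | ∃ I, M.Indep I ∧ I ⊆ S ∧ I.ncard = c})
    ⟨0, ∅, M.empty_indep, Set.empty_subset S, Set.ncard_empty α⟩ ⟨Nat.card α, ?_⟩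
  rintro _ ⟨J, -, -, rfl⟩
  exact Set.ncard_le_card J

/-- The truncation to rank at most `m` of the matroid with loops `L` in which two nonloops
are parallel when they have the same colour. -/
def colourMatroid {α β : Type*} [Finite α] (c : α → β) (L : Set α) (m : ℕ) : Matroid α :=
  (IndepMatroid.ofFinite (E := Set.univ) Set.finite_univ
    (fun I ↦ Disjoint I L ∧ Set.InjOn c I ∧ I.ncard ≤ m)
    ⟨Set.empty_disjoint L, Set.injOn_empty c, by simp⟩
    (fun _ J hJ hIJ ↦ ⟨hJ.1.mono_left hIJ, hJ.2.1.mono hIJ,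
      (Set.ncard_le_ncard hIJ J.toFinite).trans hJ.2.2⟩)
    (by
      rintro I J ⟨hIL, hI, -⟩ ⟨hJL, hJ, hJm⟩ hIJ
      have hlt : (c '' I).ncard < (c '' J).ncard := by
        rwa [hI.ncard_image, hJ.ncard_image]
      obtain ⟨_, ⟨e, heJ, rfl⟩, heI⟩ :=
        Set.exists_mem_notMem_of_ncard_lt_ncard hlt (I.toFinite.image c)
      have he : e ∉ I := fun h ↦ heI ⟨e, h, rfl⟩
      refine ⟨e, heJ, he, ?_, (Set.injOn_insert he).2 ⟨hI, heI⟩, ?_⟩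
      · exact Set.disjoint_insert_left.2 ⟨Set.disjoint_left.1 hJL heJ, hIL⟩
      · rw [Set.ncard_insert_of_notMem he]
        omega)
    (fun I _ ↦ Set.subset_univ I)).matroid

theorem colourMatroid_indep_iff {α β : Type*} [Finite α] {c : α → β} {L I : Set α} {m : ℕ} :
    (colourMatroid c L m).Indep I ↔ Disjoint I L ∧ Set.InjOn c I ∧ I.ncard ≤ m := by
  rfl

/-- A matroid in which all the elements of `L` are loops and each of the `S i` has rank at most
one has no large independent sets. -/
theorem ncard_indep_add_ncard_le {α ι : Type*} [Finite α] [Finite ι] {M : Matroid α}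
    {L : Set α} {S : ι → Set α} {I : Set α} (hI : M.Indep I)
    (hL : ∀ x ∈ L, M.Dep {x}) (hS : ∀ i, setRank M (S i) ≤ 1) :
    I.ncard + ((⋃ i, S i) ∪ L).ncard ≤ Nat.card α + Nat.card ι := by
  have hIL : ∀ x ∈ I, x ∉ L := fun x hx hxL ↦
    (hL x hxL).not_indep (hI.subset (Set.singleton_subset_iff.2 hx))
  have hIS : (I ∩ ⋃ i, S i).ncard ≤ Nat.card ι := by
    have hmem : ∀ x : ↥(I ∩ ⋃ i, S i), ∃ i, x.1 ∈ S i := fun x ↦ Set.mem_iUnion.1 x.2.2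
    choose f hf using hmem
    refine Nat.card_le_card_of_injective f fun x y hxy ↦ Subtype.ext ?_
    have h := (le_setRank (hI.subset Set.inter_subset_left) Set.inter_subset_right).trans
      (hS (f x))
    exact (Set.ncard_le_one (Set.toFinite _)).1 h x ⟨x.2.1, hf x⟩ y ⟨y.2.1, hxy ▸ hf y⟩
  have hsub : I ⊆ (I ∩ ⋃ i, S i) ∪ ((⋃ i, S i) ∪ L)ᶜ := by
    intro x hx
    by_cases h : x ∈ ⋃ i, S i
    · exact Or.inl ⟨hx, h⟩
    · exact Or.inr fun h' ↦ h'.elim h (hIL x hx)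
  have h1 := (Set.ncard_le_ncard hsub (Set.toFinite _)).trans (Set.ncard_union_le _ _)
  have h2 := Set.ncard_add_ncard_compl ((⋃ i, S i) ∪ L)
  omega

/-- Let `1 ≤ n - k`, let `L ⊆ Fin n`, and let `S 0, …, S (r-1)` be pairwise disjoint
subsets of `Fin n` with `S i \ L` nonempty for every `i`.  Then there exists a matroid
`M` on the full ground set `Fin n` of rank `n - k`, whose set of loops is exactly `L`,
and with `rank_M (S i) = 1` for every `i`, if and only if
`k + r ≥ |S 0 ∪ ⋯ ∪ S (r-1) ∪ L|`. -/
theorem exists_matroid_iff_count {n k r : ℕ} (hnk : 1 ≤ n - k)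
    (L : Set (Fin n)) (S : Fin r → Set (Fin n))
    (hdisj : Pairwise (Function.onFun Disjoint S))
    (hSL : ∀ i, (S i \ L).Nonempty) :
    (∃ M : Matroid (Fin n), M.E = Set.univ ∧ setRank M Set.univ = n - k ∧
        (∀ x : Fin n, M.Dep {x} ↔ x ∈ L) ∧ ∀ i, setRank M (S i) = 1) ↔
      ((⋃ i, S i) ∪ L).ncard ≤ k + r := by
  constructor
  · rintro ⟨M, -, hM, hL, hS⟩
    obtain ⟨I, hI, -, hIcard⟩ := exists_indep_ncard_eq_setRank M Set.univ
    have h := ncard_indep_add_ncard_le hI (fun x ↦ (hL x).2) fun i ↦ (hS i).le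
    rw [Nat.card_fin, Nat.card_fin] at h
    omega
  intro hcard
  have hc : ∀ x, ∃ y : Fin r ⊕ Fin n,
      (∀ i, x ∈ S i → y = Sum.inl i) ∧ (x ∉ ⋃ i, S i → y = Sum.inr x) := by
    intro x
    by_cases hx : x ∈ ⋃ i, S i
    · obtain ⟨i, hi⟩ := Set.mem_iUnion.1 hx
      refine ⟨Sum.inl i, fun j hj ↦ congrArg Sum.inl ?_, fun h ↦ (h hx).elim⟩
      by_contra hij
      exact Set.disjoint_left.1 (hdisj hij) hi hj
    · exact ⟨Sum.inr x, fun i hi ↦ (hx (Set.mem_iUnion_of_mem i hi)).elim, fun _ ↦ rfl⟩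
  choose c hcS hcU using hc
  choose t htS htL using fun i ↦ (Set.nonempty_def.1 (hSL i)).imp fun _ h ↦ (Set.mem_sdiff _).1 h
  have hsingle : ∀ x, x ∉ L → (colourMatroid c L (n - k)).Indep {x} := fun x hx ↦
    colourMatroid_indep_iff.2 ⟨Set.disjoint_singleton_left.2 hx, Set.injOn_singleton c x, by simpa⟩
  refine ⟨colourMatroid c L (n - k), rfl, le_antisymm ?_ ?_, fun x ↦ ⟨?_, ?_⟩, fun i ↦
    le_antisymm ?_ ?_⟩
  · exact setRank_le fun I hI _ ↦ (colourMatroid_indep_iff.1 hI).2.2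
  · have htc : ∀ i, c (t i) = Sum.inl i := fun i ↦ hcS _ i (htS i)
    have ht : Function.Injective t := fun i j hij ↦
      Sum.inl_injective (by rw [← htc i, ← htc j, hij])
    have hcC : ∀ x ∈ ((⋃ i, S i) ∪ L)ᶜ, c x = Sum.inr x := fun x hx ↦
      hcU x fun h ↦ hx (Or.inl h)
    have hinj : Set.InjOn c (Set.range t ∪ ((⋃ i, S i) ∪ L)ᶜ) := by
      rintro _ (⟨i, rfl⟩ | hx) _ (⟨j, rfl⟩ | hy) hxy
      · rw [htc, htc] at hxy
        rw [Sum.inl_injective hxy]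
      · simp [htc, hcC _ hy] at hxy
      · simp [htc, hcC _ hx] at hxy
      · rw [hcC _ hx, hcC _ hy] at hxy
        exact Sum.inr_injective hxy
    have hTL : Disjoint (Set.range t ∪ ((⋃ i, S i) ∪ L)ᶜ) L := by
      rw [Set.disjoint_left]
      rintro _ (⟨i, rfl⟩ | hx) h
      · exact htL i h
      · exact hx (Or.inr h)
    have hdisj' : Disjoint (Set.range t) ((⋃ i, S i) ∪ L)ᶜ := by
      rw [Set.disjoint_left]
      rintro _ ⟨i, rfl⟩ h
      exact h (Or.inl (Set.mem_iUnion_of_mem i (htS i)))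
    have hT : n - k ≤ (Set.range t ∪ ((⋃ i, S i) ∪ L)ᶜ).ncard := by
      have h := Set.ncard_add_ncard_compl ((⋃ i, S i) ∪ L)
      rw [Set.ncard_union_eq hdisj', Set.ncard_range_of_injective ht, Nat.card_fin]
      rw [Nat.card_fin] at h
      omega
    obtain ⟨I, hIT, hI⟩ := Set.exists_subset_card_eq hT
    have hle := le_setRank (S := Set.univ) (colourMatroid_indep_iff.2
      ⟨hTL.mono_left hIT, hinj.mono hIT, hI.le⟩) (Set.subset_univ I)
    rwa [hI] at hle
  · intro hx
    by_contra hxL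
    exact hx.not_indep (hsingle x hxL)
  · intro hxL
    refine ⟨fun h ↦ ?_, Set.subset_univ _⟩
    exact Set.disjoint_left.1 (colourMatroid_indep_iff.1 h).1 rfl hxL
  · refine setRank_le fun I hI hIS ↦ (Set.ncard_le_one I.toFinite).2 fun x hx y hy ↦ ?_
    exact (colourMatroid_indep_iff.1 hI).2.1 hx hy (by rw [hcS x i (hIS hx), hcS y i (hIS hy)])
  · simpa using le_setRank (hsingle (t i) (htL i)) (Set.singleton_subset_iff.2 (htS i))
end

section
/- For all natural numbers n and k and every real number t (equivalently, as an identity of polynomials in ℤ[t]): the sum of t^(2·|L| + |T|) over all ordered pairs (L, T) of disjoint finite subsets L, T ⊆ Fin n with |L| + |T| ≤ k equals ∑_{c=0}^{k} C(n, c) · t^c · (1 + t)^c, where C(n, c) denotes the binomial coefficient. -/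
/-- Summing a function of the cardinality over the subsets with at most `k` elements. -/
theorem sum_filter_card_le {α R : Type*} [Fintype α] [CommSemiring R] (k : ℕ) (f : ℕ → R) :
    ∑ S ∈ Finset.univ.filter (fun S : Finset α => S.card ≤ k), f S.card
      = ∑ c ∈ Finset.range (k + 1), ((Fintype.card α).choose c : R) * f c := by
  rw [← Finset.sum_fiberwise_of_maps_to (t := Finset.range (k + 1)) (g := Finset.card)
    (fun S hS => by simpa [Nat.lt_succ_iff] using hS)]
  refine Finset.sum_congr rfl fun c hc => ?_
  have h : (Finset.univ.filter (fun S : Finset α => S.card ≤ k)).filter (fun S => S.card = c)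
      = Finset.powersetCard c Finset.univ := by
    ext S
    simp only [Finset.mem_range] at hc
    simp only [Finset.mem_filter, Finset.mem_univ, Finset.mem_powersetCard,
      Finset.subset_univ, true_and]
    omega
  rw [h, Finset.sum_congr rfl fun S hS => by rw [(Finset.mem_powersetCard.1 hS).2]]
  simp [Finset.card_univ]

/-- A sum over disjoint pairs, grouped by the union of the pair. -/
theorem sum_disjoint_pairs_card_le {α R : Type*} [Fintype α] [DecidableEq α] [AddCommMonoid R]
    (k : ℕ) (f : Finset α → Finset α → R) :
    ∑ p ∈ Finset.univ.filter (fun p : Finset α × Finset α =>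
        Disjoint p.1 p.2 ∧ p.1.card + p.2.card ≤ k), f p.1 p.2
      = ∑ S ∈ Finset.univ.filter (fun S : Finset α => S.card ≤ k),
          ∑ L ∈ S.powerset, f L (S \ L) := by
  rw [Finset.sum_sigma']
  refine Finset.sum_bij' (fun p _ => ⟨p.1 ∪ p.2, p.1⟩) (fun x _ => (x.2, x.1 \ x.2)) ?_ ?_ ?_ ?_ ?_
  · rintro ⟨L, T⟩ hp
    obtain ⟨hd, hk⟩ := (Finset.mem_filter.1 hp).2
    simp only [Finset.mem_sigma, Finset.mem_filter, Finset.mem_univ, true_and,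
      Finset.mem_powerset, Finset.card_union_of_disjoint hd]
    exact ⟨hk, Finset.subset_union_left⟩
  · rintro ⟨S, L⟩ hx
    simp only [Finset.mem_sigma, Finset.mem_filter, Finset.mem_univ, true_and,
      Finset.mem_powerset] at hx
    have := Finset.card_sdiff_add_card_eq_card hx.2
    simp only [Finset.mem_filter, Finset.mem_univ, true_and]
    exact ⟨Finset.disjoint_sdiff, by omega⟩
  · rintro ⟨L, T⟩ hp
    obtain ⟨hd, -⟩ := (Finset.mem_filter.1 hp).2
    simp [Finset.union_sdiff_cancel_left hd]
  · rintro ⟨S, L⟩ hx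
    simp only [Finset.mem_sigma, Finset.mem_powerset] at hx
    simp [Finset.union_sdiff_of_subset hx.2]
  · rintro ⟨L, T⟩ hp
    obtain ⟨hd, -⟩ := (Finset.mem_filter.1 hp).2
    simp [Finset.union_sdiff_cancel_left hd]

open Finset in
/-- The corank generating function of the face poset `P_{n,k}` of the `m = 2`
amplituhedron: summing `t^(2|L| + |T|)` over all pairs `(L, T)` of disjoint subsets of
`Fin n` with `|L| + |T| ≤ k` gives `∑_{c=0}^{k} C(n,c) t^c (1+t)^c`. -/
theorem corank_generating_function (n k : ℕ) (t : ℝ) :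
    ∑ p ∈ Finset.univ.filter
        (fun p : Finset (Fin n) × Finset (Fin n) =>
          Disjoint p.1 p.2 ∧ p.1.card + p.2.card ≤ k),
      t ^ (2 * p.1.card + p.2.card)
    = ∑ c ∈ Finset.range (k + 1), (n.choose c : ℝ) * t ^ c * (1 + t) ^ c := by
  rw [sum_disjoint_pairs_card_le k (fun L T : Finset (Fin n) => t ^ (2 * L.card + T.card))]
  have h (S : Finset (Fin n)) :
      ∑ L ∈ S.powerset, t ^ (2 * L.card + (S \ L).card) = t ^ S.card * (1 + t) ^ S.card := by
    rw [add_comm 1 t, ← Finset.sum_pow_mul_eq_add_pow, Finset.mul_sum]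
    refine Finset.sum_congr rfl fun L hL => ?_
    have := Finset.card_sdiff_add_card_eq_card (Finset.mem_powerset.1 hL)
    rw [one_pow, mul_one, ← pow_add]
    congr 1
    omega
  simp only [h, mul_assoc]
  simpa using sum_filter_card_le (α := Fin n) k (fun c => t ^ c * (1 + t) ^ c)
end
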